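/- Let a, b, c > 0 with a+b > c. Then x^{a+b−c}·M(a,b,c,x) → (a+b−c)B(c, a+b−c)/B(a,b) as x → 0+, and (1−x)^{a+b−c}·M(a,b,c,x) → (a+b−c)B(c, a+b−c)/B(a,b) as x → 1−. In particular, M(a,b,c,x) → ∞ as x → 0+ and as x → 1−. -/

import Mathlib

open Filter Set

/-- Shifted factorial (Appell symbol) `(a,n) = a(a+1)⋯(a+n−1)`, with `(a,0)=1`. -/
noncomputable def shiftedFact (a : ℝ) (n : ℕ) : ℝ := ∏ i ∈ Finset.range n, (a + i)

/-- Gaussian hypergeometric function `F(a,b;c;x)` as a real power series. -/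
noncomputable def hypF (a b c x : ℝ) : ℝ :=
  ∑' n : ℕ, (shiftedFact a n * shiftedFact b n / (shiftedFact c n * (n.factorial : ℝ))) * x ^ n

/-- Beta function `B(x,y) = Γ(x)Γ(y)/Γ(x+y)`. -/
noncomputable def betaR (x y : ℝ) : ℝ := Real.Gamma x * Real.Gamma y / Real.Gamma (x + y)

/-- `M(a,b,c,x) = x(1−x)(v₁(x)v'(x) − v(x)v₁'(x))` with `v(x)=F(a,b;c;x)`, `v₁(x)=F(a,b;c;1−x)`. -/
noncomputable def Mfun (a b c x : ℝ) : ℝ :=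
  x * (1 - x) * (hypF a b c (1 - x) * deriv (fun t => hypF a b c t) x
    - hypF a b c x * deriv (fun t => hypF a b c (1 - t)) x)

/-- The `n`-th Taylor coefficient of `F(a,b;c;x)`. -/
noncomputable def hypCoeff (a b c : ℝ) (n : ℕ) : ℝ :=
  shiftedFact a n * shiftedFact b n / (shiftedFact c n * (n.factorial : ℝ))

lemma hypF_eq_tsum (a b c x : ℝ) : hypF a b c x = ∑' n, hypCoeff a b c n * x ^ n := rfl

lemma shiftedFact_pos {a : ℝ} (ha : 0 < a) (n : ℕ) : 0 < shiftedFact a n :=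
  Finset.prod_pos fun i _ => by positivity

lemma shiftedFact_succ (a : ℝ) (n : ℕ) : shiftedFact a (n + 1) = shiftedFact a n * (a + n) :=
  Finset.prod_range_succ _ _

lemma shiftedFact_succ' (a : ℝ) (n : ℕ) : shiftedFact a (n + 1) = a * shiftedFact (a + 1) n := by
  rw [shiftedFact, Finset.prod_range_succ', mul_comm, shiftedFact]
  congr 1
  · simp
  · refine Finset.prod_congr rfl fun i _ => ?_
    push_cast
    ring

lemma shiftedFact_one (n : ℕ) : shiftedFact 1 n = n.factorial := by
  induction n with
  | zero => simp [shiftedFact]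
  | succ n ih => rw [shiftedFact_succ, ih, Nat.factorial_succ]; push_cast; ring

lemma hypCoeff_pos {a b c : ℝ} (ha : 0 < a) (hb : 0 < b) (hc : 0 < c) (n : ℕ) :
    0 < hypCoeff a b c n := by
  have := shiftedFact_pos ha n
  have := shiftedFact_pos hb n
  have := shiftedFact_pos hc n
  unfold hypCoeff
  positivity

lemma hypCoeff_succ {a b c : ℝ} (n : ℕ) :
    hypCoeff a b c (n + 1) = hypCoeff a b c n * ((a + n) * (b + n) / ((c + n) * (n + 1))) := by
  simp only [hypCoeff, shiftedFact_succ, Nat.factorial_succ, div_mul_div_comm]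
  push_cast
  congr 1 <;> ring

lemma hypCoeff_succ_mul {a b c : ℝ} (n : ℕ) :
    hypCoeff a b c (n + 1) * (n + 1) = a * b / c * hypCoeff (a + 1) (b + 1) (c + 1) n := by
  have : (n : ℝ) + 1 ≠ 0 := by positivity
  simp only [hypCoeff, shiftedFact_succ', Nat.factorial_succ, div_mul_div_comm]
  push_cast
  rw [div_mul_eq_mul_div,
    show c * shiftedFact (c + 1) n * (((n : ℝ) + 1) * n.factorial)
      = c * (shiftedFact (c + 1) n * n.factorial) * (n + 1) by ring,
    mul_div_mul_right _ _ this]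
  congr 1
  ring

lemma summable_hypCoeff_mul_pow {a b c x : ℝ} (ha : 0 < a) (hb : 0 < b) (hc : 0 < c)
    (hx : |x| < 1) : Summable fun n => hypCoeff a b c n * x ^ n := by
  rcases eq_or_ne x 0 with rfl | hx0
  · refine summable_of_ne_finset_zero (s := {0}) fun n hn => ?_
    simp at hn
    simp [hn]
  refine summable_of_ratio_test_tendsto_lt_one hx
    (.of_forall fun n => mul_ne_zero (hypCoeff_pos ha hb hc n).ne' (pow_ne_zero _ hx0)) ?_
  have h1 := tendsto_add_mul_div_add_mul_atTop_nhds a c 1 (one_ne_zero (α := ℝ))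
  have h2 := tendsto_add_mul_div_add_mul_atTop_nhds b 1 1 (one_ne_zero (α := ℝ))
  have h := (h1.mul h2).mul_const |x|
  simp only [div_one, one_mul] at h
  refine h.congr fun n => ?_
  have hn := hypCoeff_pos ha hb hc n
  have hx' : 0 < |x| := abs_pos.mpr hx0
  rw [hypCoeff_succ, pow_succ]
  simp only [norm_mul, Real.norm_eq_abs, norm_pow]
  rw [abs_of_pos hn, abs_of_pos (by positivity : 0 < (a + n) * (b + n) / ((c + n) * (n + 1)))]
  field_simp
  ring

lemma hasDerivAt_hypF {a b c x : ℝ} (ha : 0 < a) (hb : 0 < b) (hc : 0 < c) (hx : |x| < 1) :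
    HasDerivAt (hypF a b c) (a * b / c * hypF (a + 1) (b + 1) (c + 1) x) x := by
  obtain ⟨r, hxr, hr1⟩ := exists_between hx
  have hr0 : 0 < r := (abs_nonneg x).trans_lt hxr
  have hsucc (y : ℝ) (n : ℕ) :
      hypCoeff a b c (n + 1) * (((n + 1 : ℕ) : ℝ) * y ^ (n + 1 - 1))
        = a * b / c * (hypCoeff (a + 1) (b + 1) (c + 1) n * y ^ n) := by
    rw [← mul_assoc (a * b / c), ← hypCoeff_succ_mul]
    push_cast
    ring
  have hsum {y : ℝ} (hy : |y| < 1) :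
      Summable fun n => hypCoeff a b c n * ((n : ℝ) * y ^ (n - 1)) := by
    rw [← summable_nat_add_iff 1]
    exact ((summable_hypCoeff_mul_pow (by positivity) (by positivity) (by positivity) hy).mul_left
      _).congr fun n => (hsucc y n).symm
  have key := hasDerivAt_tsum_of_isPreconnected (t := Ioo (-r) r) (y₀ := x) (y := x)
    (g := fun n y => hypCoeff a b c n * y ^ n)
    (g' := fun n y => hypCoeff a b c n * ((n : ℝ) * y ^ (n - 1)))
    (hsum (by rwa [abs_of_pos hr0])) isOpen_Ioo isPreconnected_Ioo
    (fun n y _ => (hasDerivAt_pow n y).const_mul _) (fun n y hy => ?_) (abs_lt.mp hxr)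
    (summable_hypCoeff_mul_pow ha hb hc hx) (abs_lt.mp hxr)
  · rw [(hsum hx).tsum_eq_zero_add] at key
    simp only [hsucc, tsum_mul_left, Nat.cast_zero, zero_mul, mul_zero, zero_add] at key
    exact key
  · have := (hypCoeff_pos ha hb hc n).le
    rw [norm_mul, norm_mul, norm_pow, Real.norm_of_nonneg this, Real.norm_natCast]
    gcongr
    exact (abs_lt.mpr hy).le

lemma hypF_one_one {p x : ℝ} (hx : |x| < 1) : hypF p 1 1 x = 1 / (1 - x) ^ p := by
  have h := (Real.one_div_one_sub_rpow_hasFPowerSeriesOnBall_zero p).hasSum (y := x)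
    (by simpa [Metric.mem_eball, edist_zero_right, enorm_eq_nnnorm, ← NNReal.coe_lt_coe] using hx)
  simp only [FormalMultilinearSeries.ofScalars_apply_eq, smul_eq_mul, zero_add] at h
  rw [← h.tsum_eq, hypF]
  refine tsum_congr fun n => ?_
  congr 1
  have hf : (n.factorial : ℝ) ≠ 0 := by positivity
  have hasc : (ascPochhammer ℕ n).smeval p = shiftedFact p n := by
    rw [Polynomial.ascPochhammer_smeval_eq_eval]
    induction n with
    | zero => simp [shiftedFact]
    | succ n ih => rw [ascPochhammer_succ_eval, ih (by positivity), shiftedFact_succ]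
  have h2 := Ring.factorial_nsmul_multichoose_eq_ascPochhammer p n
  rw [hasc, nsmul_eq_mul] at h2
  rw [Ring.choose, show p + n - 1 - n + 1 = p by ring, shiftedFact_one, ← h2]
  field_simp

/-- An Abelian theorem: if the coefficients of two power series have a limiting ratio, and the
second series has positive coefficients and diverges at `1`, then so do the sums at `1`. -/
lemma tendsto_tsum_div_tsum {A B : ℕ → ℝ} {L : ℝ} (hB : ∀ n, 0 < B n)
    (hsA : ∀ x ∈ Ioo (0 : ℝ) 1, Summable fun n => A n * x ^ n)
    (hsB : ∀ x ∈ Ioo (0 : ℝ) 1, Summable fun n => B n * x ^ n)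
    (htop : Tendsto (fun x : ℝ => ∑' n, B n * x ^ n) (nhdsWithin 1 (Iio 1)) atTop)
    (h : Tendsto (fun n => A n / B n) atTop (nhds L)) :
    Tendsto (fun x : ℝ => (∑' n, A n * x ^ n) / ∑' n, B n * x ^ n)
      (nhdsWithin 1 (Iio 1)) (nhds L) := by
  rw [Metric.tendsto_nhds]
  intro ε hε
  obtain ⟨N, hN⟩ := eventually_atTop.mp (Metric.tendsto_nhds.mp h (ε / 2) (half_pos hε))
  set K : ℕ → ℝ := fun n => if n < N then |A n - L * B n| else 0 with hK
  have hKs : Summable K := summable_of_ne_finset_zero (s := Finset.range N) fun n hn => by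
    simp only [Finset.mem_range] at hn
    simp [hK, hn]
  filter_upwards [htop.eventually_gt_atTop (2 * (∑' n, K n) / ε), htop.eventually_gt_atTop 0,
    Ioo_mem_nhdsLT (zero_lt_one (α := ℝ))] with x hx hpos hx01
  have hA := hsA x hx01
  have hBx := hsB x hx01
  have hbound (n : ℕ) : ‖A n * x ^ n - L * (B n * x ^ n)‖ ≤ K n + ε / 2 * (B n * x ^ n) := by
    have hxn : 0 ≤ x ^ n := pow_nonneg hx01.1.le n
    have hxn1 : x ^ n ≤ 1 := pow_le_one₀ hx01.1.le hx01.2.le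
    have hBn := hB n
    rw [show A n * x ^ n - L * (B n * x ^ n) = (A n - L * B n) * x ^ n by ring, norm_mul,
      Real.norm_eq_abs, Real.norm_of_nonneg hxn]
    by_cases hn : n < N
    · have : K n = |A n - L * B n| := by simp [hK, hn]
      rw [this]
      have : 0 ≤ ε / 2 * (B n * x ^ n) := by positivity
      nlinarith [mul_le_of_le_one_right (abs_nonneg (A n - L * B n)) hxn1]
    · have : K n = 0 := by simp [hK, hn]
      rw [this, zero_add, ← mul_assoc]
      refine mul_le_mul_of_nonneg_right ?_ hxn
      have h3 := hN n (not_lt.mp hn)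
      rw [Real.dist_eq, show A n / B n - L = (A n - L * B n) / B n by field_simp, abs_div,
        abs_of_pos hBn, div_lt_iff₀ hBn] at h3
      exact h3.le
  have hle := tsum_of_norm_bounded (hKs.add (hBx.mul_left (ε / 2))).hasSum hbound
  rw [hA.tsum_sub (hBx.mul_left L), hKs.tsum_add (hBx.mul_left _), tsum_mul_left,
    tsum_mul_left, Real.norm_eq_abs] at hle
  rw [div_lt_iff₀ hε] at hx
  rw [Real.dist_eq, div_sub' hpos.ne', abs_div, abs_of_pos hpos, div_lt_iff₀ hpos, mul_comm _ L]
  linarith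

lemma tendsto_hypCoeff_div {a b c s : ℝ} (ha : 0 < a) (hb : 0 < b) (hc : 0 < c) (hs : 0 < s)
    (habc : a + b = c + s) :
    Tendsto (fun n => hypCoeff a b c n / hypCoeff s 1 1 n) atTop
      (nhds (Real.Gamma c * Real.Gamma s / (Real.Gamma a * Real.Gamma b))) := by
  rw [← tendsto_add_atTop_iff_nat 1]
  have hG := ((Real.GammaSeq_tendsto_Gamma c).mul (Real.GammaSeq_tendsto_Gamma s)).div
    ((Real.GammaSeq_tendsto_Gamma a).mul (Real.GammaSeq_tendsto_Gamma b))
    (mul_pos (Real.Gamma_pos_of_pos ha) (Real.Gamma_pos_of_pos hb)).ne'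
  refine hG.congr' ?_
  filter_upwards [eventually_gt_atTop 0] with n hn
  have hn0 : (0 : ℝ) < n := by exact_mod_cast hn
  have hpow : (n : ℝ) ^ a * (n : ℝ) ^ b = (n : ℝ) ^ c * (n : ℝ) ^ s := by
    rw [← Real.rpow_add hn0, ← Real.rpow_add hn0, habc]
  have hseq (t : ℝ) : Real.GammaSeq t n = (n : ℝ) ^ t * n.factorial / shiftedFact t (n + 1) := rfl
  have := shiftedFact_pos ha (n + 1)
  have := shiftedFact_pos hb (n + 1)
  have := shiftedFact_pos hc (n + 1)
  have := shiftedFact_pos hs (n + 1)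
  have := Real.rpow_pos_of_pos hn0 a
  have := Real.rpow_pos_of_pos hn0 b
  have := Real.rpow_pos_of_pos hn0 c
  have := Real.rpow_pos_of_pos hn0 s
  simp only [Pi.div_apply, hypCoeff, hseq, shiftedFact_one]
  field_simp
  linear_combination -hpow

lemma tendsto_one_sub_nhdsLT_one : Tendsto (fun x : ℝ => 1 - x) (nhdsWithin 1 (Iio 1))
    (nhdsWithin 0 (Ioi 0)) := by
  refine tendsto_nhdsWithin_iff.mpr ⟨?_, ?_⟩
  · exact ((continuous_const.sub continuous_id).tendsto' (1 : ℝ) 0 (by simp)).mono_left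
      nhdsWithin_le_nhds
  · filter_upwards [self_mem_nhdsWithin] with x hx
    simpa using hx

lemma tendsto_one_sub_nhdsGT_zero : Tendsto (fun x : ℝ => 1 - x) (nhdsWithin 0 (Ioi 0))
    (nhdsWithin 1 (Iio 1)) := by
  refine tendsto_nhdsWithin_iff.mpr ⟨?_, ?_⟩
  · exact ((continuous_const.sub continuous_id).tendsto' (0 : ℝ) 1 (by simp)).mono_left
      nhdsWithin_le_nhds
  · filter_upwards [self_mem_nhdsWithin] with x hx
    simpa using hx

/-- The singular behaviour of `F(a,b;c;x)` at `x = 1` when `a + b > c`. -/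
lemma tendsto_rpow_mul_hypF {a b c s : ℝ} (ha : 0 < a) (hb : 0 < b) (hc : 0 < c) (hs : 0 < s)
    (habc : a + b = c + s) :
    Tendsto (fun x : ℝ => (1 - x) ^ s * hypF a b c x) (nhdsWithin 1 (Iio 1))
      (nhds (Real.Gamma c * Real.Gamma s / (Real.Gamma a * Real.Gamma b))) := by
  have habs {x : ℝ} (hx : x ∈ Ioo (0 : ℝ) 1) : |x| < 1 := by rw [abs_of_pos hx.1]; exact hx.2
  have hev : ∀ᶠ x : ℝ in nhdsWithin 1 (Iio 1), x ∈ Ioo (0 : ℝ) 1 :=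
    Ioo_mem_nhdsLT zero_lt_one
  have htop : Tendsto (fun x : ℝ => ∑' n, hypCoeff s 1 1 n * x ^ n) (nhdsWithin 1 (Iio 1))
      atTop := by
    refine ((tendsto_rpow_neg_nhdsGT_zero (neg_lt_zero.mpr hs)).comp
      tendsto_one_sub_nhdsLT_one).congr' ?_
    filter_upwards [hev] with x hx
    rw [← hypF_eq_tsum, hypF_one_one (habs hx), Function.comp_apply,
      Real.rpow_neg (sub_pos.mpr hx.2).le, one_div]
  refine (tendsto_tsum_div_tsum (hypCoeff_pos hs one_pos one_pos)
    (fun x hx => summable_hypCoeff_mul_pow ha hb hc (habs hx))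
    (fun x hx => summable_hypCoeff_mul_pow hs one_pos one_pos (habs hx)) htop
    (tendsto_hypCoeff_div ha hb hc hs habc)).congr' ?_
  filter_upwards [hev] with x hx
  rw [← hypF_eq_tsum, ← hypF_eq_tsum, hypF_one_one (habs hx)]
  field_simp

lemma hypF_zero (a b c : ℝ) : hypF a b c 0 = 1 := by
  rw [hypF, tsum_eq_single 0 fun n hn => by simp [hn]]
  simp [shiftedFact]

lemma tendsto_hypF_one_sub {a b c : ℝ} (ha : 0 < a) (hb : 0 < b) (hc : 0 < c) :
    Tendsto (fun x : ℝ => hypF a b c (1 - x)) (nhdsWithin 1 (Iio 1)) (nhds 1) := by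
  have h := (hasDerivAt_hypF ha hb hc (x := 0) (by simp)).continuousAt.tendsto
  rw [hypF_zero] at h
  exact h.comp (tendsto_one_sub_nhdsLT_one.mono_right nhdsWithin_le_nhds)

lemma Mfun_eq {a b c x : ℝ} (ha : 0 < a) (hb : 0 < b) (hc : 0 < c) (hx : x ∈ Ioo (0 : ℝ) 1) :
    Mfun a b c x = x * (1 - x) * (a * b / c) *
      (hypF a b c (1 - x) * hypF (a + 1) (b + 1) (c + 1) x
        + hypF a b c x * hypF (a + 1) (b + 1) (c + 1) (1 - x)) := by
  obtain ⟨h0, h1⟩ := hx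
  have hd := hasDerivAt_hypF ha hb hc (x := x) (abs_lt.mpr ⟨by linarith, h1⟩)
  have hd' := (hasDerivAt_hypF ha hb hc (x := 1 - x)
    (abs_lt.mpr ⟨by linarith, by linarith⟩)).comp x ((hasDerivAt_id x).const_sub 1)
  have e : deriv (fun t => hypF a b c (1 - t)) x = _ := hd'.deriv
  rw [Mfun, e, hd.deriv]
  ring

lemma Mfun_one_sub {a b c x : ℝ} (ha : 0 < a) (hb : 0 < b) (hc : 0 < c) (hx : x ∈ Ioo (0 : ℝ) 1) :
    Mfun a b c (1 - x) = Mfun a b c x := by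
  rw [Mfun_eq ha hb hc hx, Mfun_eq ha hb hc ⟨by linarith [hx.2], by linarith [hx.1]⟩,
    sub_sub_cancel]
  ring

lemma tendsto_rpow_mul_Mfun {a b c : ℝ} (ha : 0 < a) (hb : 0 < b) (hc : 0 < c) (h1 : c < a + b) :
    Tendsto (fun x : ℝ => (1 - x) ^ (a + b - c) * Mfun a b c x) (nhdsWithin 1 (Iio 1))
      (nhds ((a + b - c) * betaR c (a + b - c) / betaR a b)) := by
  have hs : 0 < a + b - c := by linarith
  have hF := tendsto_rpow_mul_hypF ha hb hc hs (by ring)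
  have hF' := tendsto_rpow_mul_hypF (a := a + 1) (b := b + 1) (c := c + 1) (s := a + b - c + 1)
    (by linarith) (by linarith) (by linarith) (by linarith) (by ring)
  have hv := tendsto_hypF_one_sub ha hb hc
  have hv' := tendsto_hypF_one_sub (a := a + 1) (b := b + 1) (c := c + 1)
    (by linarith) (by linarith) (by linarith)
  have hx : Tendsto (fun x : ℝ => x) (nhdsWithin 1 (Iio 1)) (nhds 1) := nhdsWithin_le_nhds
  have hx' : Tendsto (fun x : ℝ => 1 - x) (nhdsWithin 1 (Iio 1)) (nhds 0) :=
    tendsto_one_sub_nhdsLT_one.mono_right nhdsWithin_le_nhds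
  have hlim := (hx.mul_const (a * b / c)).mul ((hv.mul hF').add (hx'.mul (hF.mul hv')))
  have hval : 1 * (a * b / c) * (1 * (Real.Gamma (c + 1) * Real.Gamma (a + b - c + 1) /
      (Real.Gamma (a + 1) * Real.Gamma (b + 1))) + 0 * (Real.Gamma c * Real.Gamma (a + b - c) /
      (Real.Gamma a * Real.Gamma b) * 1))
      = (a + b - c) * betaR c (a + b - c) / betaR a b := by
    have := Real.Gamma_pos_of_pos ha
    have := Real.Gamma_pos_of_pos hb
    have := Real.Gamma_pos_of_pos (add_pos ha hb)
    rw [Real.Gamma_add_one ha.ne', Real.Gamma_add_one hb.ne', Real.Gamma_add_one hc.ne',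
      Real.Gamma_add_one hs.ne', betaR, betaR, add_sub_cancel]
    field_simp
    ring
  rw [hval] at hlim
  refine hlim.congr' ?_
  filter_upwards [Ioo_mem_nhdsLT (zero_lt_one (α := ℝ))] with x hx01
  rw [Mfun_eq ha hb hc hx01, Real.rpow_add_one (sub_pos.mpr hx01.2).ne']
  ring

theorem stmt8 (a b c : ℝ) (ha : 0 < a) (hb : 0 < b) (hc : 0 < c) (h1 : c < a + b) :
    Tendsto (fun x : ℝ => x ^ (a + b - c) * Mfun a b c x) (nhdsWithin 0 (Set.Ioi 0))
      (nhds ((a + b - c) * betaR c (a + b - c) / betaR a b)) ∧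
    Tendsto (fun x : ℝ => (1 - x) ^ (a + b - c) * Mfun a b c x) (nhdsWithin 1 (Set.Iio 1))
      (nhds ((a + b - c) * betaR c (a + b - c) / betaR a b)) ∧
    Tendsto (Mfun a b c) (nhdsWithin 0 (Set.Ioi 0)) atTop ∧
    Tendsto (Mfun a b c) (nhdsWithin 1 (Set.Iio 1)) atTop := by
  have hs : 0 < a + b - c := by linarith
  have hone := tendsto_rpow_mul_Mfun ha hb hc h1
  have hL : 0 < (a + b - c) * betaR c (a + b - c) / betaR a b := by
    have := Real.Gamma_pos_of_pos ha
    have := Real.Gamma_pos_of_pos hb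
    have := Real.Gamma_pos_of_pos hc
    have := Real.Gamma_pos_of_pos hs
    have := Real.Gamma_pos_of_pos (add_pos ha hb)
    simp only [betaR, add_sub_cancel]
    positivity
  have htop : Tendsto (Mfun a b c) (nhdsWithin 1 (Iio 1)) atTop := by
    refine (((tendsto_rpow_neg_nhdsGT_zero (neg_lt_zero.mpr hs)).comp
      tendsto_one_sub_nhdsLT_one).atTop_mul_pos hL hone).congr' ?_
    filter_upwards [self_mem_nhdsWithin] with x hx
    have hx' : 0 < 1 - x := sub_pos.mpr hx
    rw [Function.comp_apply, ← mul_assoc, ← Real.rpow_add hx', neg_add_cancel, Real.rpow_zero,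
      one_mul]
  have hev : ∀ᶠ x : ℝ in nhdsWithin 0 (Ioi 0), x ∈ Ioo (0 : ℝ) 1 := Ioo_mem_nhdsGT zero_lt_one
  refine ⟨(hone.comp tendsto_one_sub_nhdsGT_zero).congr' ?_, hone,
    (htop.comp tendsto_one_sub_nhdsGT_zero).congr' ?_, htop⟩
  · filter_upwards [hev] with x hx
    rw [Function.comp_apply, sub_sub_cancel, Mfun_one_sub ha hb hc hx]
  · filter_upwards [hev] with x hx
    exact Mfun_one_sub ha hb hc hx
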